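/- arXiv:1304.4768 — 2 statements merged into one kernel-verified Lean document; each statement's English description precedes it below -/
import Mathlib

section
/- Let G be a finite connected simple graph on a vertex set V and let v ∈ V be a cut vertex in the following sense: V \ {v} is partitioned into two disjoint nonempty sets S and T such that no edge of G joins a vertex of S to a vertex of T. Let r denote the effective resistance on G defined via a Moore–Penrose pseudoinverse of the Laplacian of G, and let r₁, r₂ denote the effective resistances on the induced subgraphs G₁ on S ∪ {v} and G₂ on T ∪ {v}, defined via Moore–Penrose pseudoinverses of their Laplacians. Then for every s ∈ S and t ∈ T one has r(s,t) = r₁(s,v) + r₂(v,t). -/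
open Matrix Finset

/-- A Moore–Penrose pseudoinverse of a real matrix `L` is a matrix `P` satisfying the four
Penrose equations. -/
def IsMoorePenrose {V : Type*} [Fintype V] (L P : Matrix V V ℝ) : Prop :=
  L * P * L = L ∧ P * L * P = P ∧ (L * P)ᵀ = L * P ∧ (P * L)ᵀ = P * L

/-- The effective resistance between two vertices, defined via a Moore–Penrose
pseudoinverse `P` of the Laplacian: `r(x,y) = (δ_x − δ_y)ᵀ·P·(δ_x − δ_y)`. -/
def effRes {V : Type*} [Fintype V] [DecidableEq V] (P : Matrix V V ℝ) (x y : V) : ℝ :=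
  (Pi.single x 1 - Pi.single y 1) ⬝ᵥ P.mulVec (Pi.single x 1 - Pi.single y 1)

theorem effRes_comm {V : Type*} [Fintype V] [DecidableEq V] (P : Matrix V V ℝ) (x y : V) :
    effRes P x y = effRes P y x := by
  unfold effRes
  rw [← neg_sub (Pi.single y 1 : V → ℝ) (Pi.single x 1), mulVec_neg, neg_dotProduct_neg]

/-- The effective resistance is the potential difference of any potential inducing a unit
current flow. -/
theorem IsMoorePenrose.effRes_eq_of_mulVec_eq {V : Type*} [Fintype V] [DecidableEq V]
    {L P : Matrix V V ℝ} (hP : IsMoorePenrose L P) (hL : L.IsSymm) {f : V → ℝ} {x y : V}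
    (hf : L *ᵥ f = Pi.single x 1 - Pi.single y 1) : effRes P x y = f x - f y := by
  have key : (L *ᵥ f) ⬝ᵥ P *ᵥ (L *ᵥ f) = f ⬝ᵥ L *ᵥ f := by
    nth_rewrite 1 [← hL.eq]
    rw [mulVec_transpose, ← dotProduct_mulVec, mulVec_mulVec, mulVec_mulVec, hP.1]
  rw [effRes, ← hf, key, hf, dotProduct_sub, dotProduct_single_one, dotProduct_single_one]

namespace SimpleGraph

theorem lapMatrix_mulVec_apply_eq_sum {V : Type*} [Fintype V] [DecidableEq V]
    (G : SimpleGraph V) [DecidableRel G.Adj] (f : V → ℝ) (x : V) :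
    (G.lapMatrix ℝ *ᵥ f) x = ∑ y, if G.Adj x y then f x - f y else 0 := by
  rw [lapMatrix_mulVec_apply, ← Finset.sum_filter, ← neighborFinset_eq_filter,
    Finset.sum_sub_distrib, Finset.sum_const, card_neighborFinset_eq_degree, nsmul_eq_mul]

theorem sum_lapMatrix_mulVec {V : Type*} [Fintype V] [DecidableEq V]
    (G : SimpleGraph V) [DecidableRel G.Adj] (f : V → ℝ) :
    ∑ x, (G.lapMatrix ℝ *ᵥ f) x = 0 := by
  have h : (fun _ ↦ 1) ⬝ᵥ G.lapMatrix ℝ *ᵥ f = 0 := by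
    rw [dotProduct_mulVec, ← mulVec_transpose, (G.isSymm_lapMatrix (R := ℝ)).eq,
      lapMatrix_mulVec_const_eq_zero, zero_dotProduct]
  simpa [dotProduct] using h

theorem Connected.lapMatrix_mulVec_pseudoinverse {V : Type*} [Fintype V] [DecidableEq V]
    {G : SimpleGraph V} [DecidableRel G.Adj] (hG : G.Connected) {P : Matrix V V ℝ}
    (hP : IsMoorePenrose (G.lapMatrix ℝ) P) {b : V → ℝ} (hb : ∑ x, b x = 0) :
    G.lapMatrix ℝ *ᵥ (P *ᵥ b) = b := by
  set L := G.lapMatrix ℝ with hLdef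
  have hL : Lᵀ = L := (G.isSymm_lapMatrix (R := ℝ)).eq
  have hLLP : L * (L * P) = L := by
    rw [← hP.2.2.1, transpose_mul, hL]
    simpa [hL, Matrix.mul_assoc] using congrArg transpose hP.1
  have hker : L *ᵥ (b - L *ᵥ (P *ᵥ b)) = 0 := by
    rw [mulVec_sub, mulVec_mulVec, mulVec_mulVec, Matrix.mul_assoc, hLLP, sub_self]
  have hconst := (G.lapMatrix_mulVec_eq_zero_iff_forall_reachable).1 hker
  have hsum : ∑ x, (b - L *ᵥ (P *ᵥ b)) x = 0 := by
    simp only [Pi.sub_apply, Finset.sum_sub_distrib, hb, hLdef, sum_lapMatrix_mulVec, sub_zero]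
  funext x
  have : Nonempty V := ⟨x⟩
  rw [Finset.sum_congr rfl fun y _ ↦ hconst y x (hG.preconnected y x), Finset.sum_const,
    smul_eq_zero_iff_right (by simp)] at hsum
  exact (sub_eq_zero.1 hsum).symm

theorem lapMatrix_induce_mulVec_apply {V : Type*} [Fintype V] [DecidableEq V]
    (G : SimpleGraph V) [DecidableRel G.Adj] (A : Set V) [Fintype A] [DecidableEq A]
    [DecidableRel (G.induce A).Adj] (f : V → ℝ) (x : A) (hx : ∀ y, G.Adj x y → y ∈ A) :
    ((G.induce A).lapMatrix ℝ *ᵥ fun a ↦ f a) x = (G.lapMatrix ℝ *ᵥ f) x := by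
  rw [lapMatrix_mulVec_apply_eq_sum, lapMatrix_mulVec_apply_eq_sum]
  refine Finset.sum_of_injOn Subtype.val Subtype.val_injective.injOn (by simp) ?_ (by simp)
  intro y _ hy
  refine if_neg fun hadj ↦ hy ?_
  simpa using hx y hadj

/-- If only `v` has neighbours outside `A`, then a potential on the whole graph whose current
flow on `A \ {v}` is a unit source at `s` computes the effective resistance of the subgraph
induced on `A` between `s` and `v`. -/
theorem effRes_induce_eq_sub {V : Type*} [Fintype V] [DecidableEq V]
    (G : SimpleGraph V) [DecidableRel G.Adj] (A : Set V) [Fintype A] [DecidableEq A]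
    [DecidableRel (G.induce A).Adj] {P : Matrix A A ℝ}
    (hP : IsMoorePenrose ((G.induce A).lapMatrix ℝ) P) {s v : A}
    (hA : ∀ x : A, x ≠ v → ∀ y, G.Adj x y → y ∈ A) {f : V → ℝ}
    (hf : ∀ x : A, x ≠ v → (G.lapMatrix ℝ *ᵥ f) x = Pi.single (M := fun _ ↦ ℝ) s 1 x) :
    effRes P s v = f s - f v := by
  refine hP.effRes_eq_of_mulVec_eq ((G.induce A).isSymm_lapMatrix (R := ℝ)) (f := fun a ↦ f a) ?_
  have hoff : ∀ x : A, x ≠ v → ((G.induce A).lapMatrix ℝ *ᵥ fun a ↦ f a) x =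
      (Pi.single s 1 - Pi.single v 1 : A → ℝ) x := fun x hx ↦ by
    rw [lapMatrix_induce_mulVec_apply G A f x (hA x hx), hf x hx]
    simp [hx]
  funext x
  by_cases hx : x = v
  · subst hx
    have h₁ := (G.induce A).sum_lapMatrix_mulVec fun a ↦ f a
    have h₂ : ∑ y, (Pi.single s 1 - Pi.single x 1 : A → ℝ) y = 0 := by simp
    rw [← Finset.add_sum_erase _ _ (Finset.mem_univ x)] at h₁ h₂
    rw [Finset.sum_congr rfl fun y hy ↦ hoff y (Finset.ne_of_mem_erase hy)] at h₁
    linarith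
  · exact hoff x hx

end SimpleGraph

/-- If `v` is a cut vertex of a finite connected simple graph `G`, separating `V \ {v}`
into nonempty pieces `S` and `T` with no edge between them, then for `s ∈ S` and `t ∈ T`
the effective resistance satisfies `r(s,t) = r₁(s,v) + r₂(v,t)`, where `r₁`, `r₂` are the
effective resistances of the induced subgraphs on `S ∪ {v}` and `T ∪ {v}`. -/
theorem effective_resistance_cut_vertex
    {V : Type*} [Fintype V] [DecidableEq V]
    (G : SimpleGraph V) [DecidableRel G.Adj] (hG : G.Connected)
    (v : V) (S T : Finset V)
    (hS : S.Nonempty) (hT : T.Nonempty) (hST : Disjoint S T)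
    (hvS : v ∉ S) (hvT : v ∉ T)
    (hpart : ∀ x : V, x ≠ v → x ∈ S ∨ x ∈ T)
    (hsep : ∀ s ∈ S, ∀ t ∈ T, ¬ G.Adj s t)
    [DecidableRel (G.induce (↑(insert v S) : Set V)).Adj]
    [DecidableRel (G.induce (↑(insert v T) : Set V)).Adj]
    (Lp : Matrix V V ℝ)
    (hLp : IsMoorePenrose (G.lapMatrix ℝ) Lp)
    (Lp₁ : Matrix (↑(insert v S) : Set V) (↑(insert v S) : Set V) ℝ)
    (hLp₁ : IsMoorePenrose ((G.induce (↑(insert v S) : Set V)).lapMatrix ℝ) Lp₁)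
    (Lp₂ : Matrix (↑(insert v T) : Set V) (↑(insert v T) : Set V) ℝ)
    (hLp₂ : IsMoorePenrose ((G.induce (↑(insert v T) : Set V)).lapMatrix ℝ) Lp₂)
    (s t : V) (hs : s ∈ S) (ht : t ∈ T) :
    effRes Lp s t =
      effRes Lp₁ ⟨s, Finset.mem_coe.mpr (Finset.mem_insert_of_mem hs)⟩
        ⟨v, Finset.mem_coe.mpr (Finset.mem_insert_self v S)⟩ +
      effRes Lp₂ ⟨v, Finset.mem_coe.mpr (Finset.mem_insert_self v T)⟩
        ⟨t, Finset.mem_coe.mpr (Finset.mem_insert_of_mem ht)⟩ := by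
  set f := Lp *ᵥ (Pi.single s 1 - Pi.single t 1)
  have hf : G.lapMatrix ℝ *ᵥ f = Pi.single s 1 - Pi.single t 1 :=
    hG.lapMatrix_mulVec_pseudoinverse hLp (by simp)
  have hr := hLp.effRes_eq_of_mulVec_eq (G.isSymm_lapMatrix (R := ℝ)) hf
  have hr₁ := G.effRes_induce_eq_sub _ hLp₁
    (s := ⟨s, Finset.mem_coe.mpr (Finset.mem_insert_of_mem hs)⟩)
    (v := ⟨v, Finset.mem_coe.mpr (Finset.mem_insert_self v S)⟩) (f := f)
    (by
      rintro ⟨x, hx⟩ hxv y hxy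
      have hxS : x ∈ S := by simpa [show x ≠ v by simpa using hxv] using hx
      by_cases hy : y = v
      · simp [hy]
      · rcases hpart y hy with h | h
        · simp [h]
        · exact absurd hxy (hsep x hxS y h))
    (by
      rintro ⟨x, hx⟩ hxv
      have hxS : x ∈ S := by simpa [show x ≠ v by simpa using hxv] using hx
      have hxt : x ≠ t := fun h ↦ Finset.disjoint_left.1 hST hxS (h ▸ ht)
      simp [hf, Pi.single_apply, hxt])
  have hr₂ := G.effRes_induce_eq_sub _ hLp₂
    (s := ⟨t, Finset.mem_coe.mpr (Finset.mem_insert_of_mem ht)⟩)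
    (v := ⟨v, Finset.mem_coe.mpr (Finset.mem_insert_self v T)⟩) (f := -f)
    (by
      rintro ⟨x, hx⟩ hxv y hxy
      have hxT : x ∈ T := by simpa [show x ≠ v by simpa using hxv] using hx
      by_cases hy : y = v
      · simp [hy]
      · rcases hpart y hy with h | h
        · exact absurd hxy.symm (hsep y h x hxT)
        · simp [h])
    (by
      rintro ⟨x, hx⟩ hxv
      have hxT : x ∈ T := by simpa [show x ≠ v by simpa using hxv] using hx
      have hxs : x ≠ s := fun h ↦ Finset.disjoint_left.1 hST hs (h ▸ hxT)
      simp [mulVec_neg, hf, Pi.single_apply, hxs])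
  rw [hr, hr₁, effRes_comm Lp₂, hr₂]
  simp only [Pi.neg_apply]
  ring
end

section
/- Let G be a finite connected simple graph on a vertex set V and let v ∈ V be such that V \ {v} is partitioned into two disjoint nonempty sets S and T with no edge of G joining a vertex of S to a vertex of T. Let G₁ and G₂ be the induced subgraphs of G on S ∪ {v} and T ∪ {v} respectively. Define pushforward maps π₁ : ℝ^V → ℝ^{S∪{v}} by (π₁d)(s) = d(s) for s ∈ S and (π₁d)(v) = d(v) + Σ_{t∈T} d(t), and π₂ : ℝ^V → ℝ^{T∪{v}} by (π₂d)(t) = d(t) for t ∈ T and (π₂d)(v) = d(v) + Σ_{s∈S} d(s). Then for all divisors d, e ∈ ℝ^V of degree zero, the Green pairings satisfy g_G(d,e) = g_{G₁}(π₁d, π₁e) + g_{G₂}(π₂d, π₂e). -/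
open Matrix Finset

/-- The graph Laplacian acts on functions as a sum of differences over neighbours. -/
theorem lapMatrix_mulVec_eq_sum_ite {W : Type*} [Fintype W] [DecidableEq W]
    (H : SimpleGraph W) [DecidableRel H.Adj] (f : W → ℝ) (x : W) :
    (H.lapMatrix ℝ *ᵥ f) x = ∑ y, if H.Adj x y then f x - f y else 0 := by
  rw [SimpleGraph.lapMatrix_mulVec_apply, ← Finset.sum_filter, Finset.sum_sub_distrib,
    ← SimpleGraph.neighborFinset_eq_filter, Finset.sum_const, nsmul_eq_mul,
    SimpleGraph.card_neighborFinset_eq_degree]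

/-- Every divisor in the image of the Laplacian has degree zero. -/
theorem sum_lapMatrix_mulVec {W : Type*} [Fintype W] [DecidableEq W]
    (H : SimpleGraph W) [DecidableRel H.Adj] (f : W → ℝ) :
    ∑ x, (H.lapMatrix ℝ *ᵥ f) x = 0 := by
  have h : (fun _ => 1 : W → ℝ) ⬝ᵥ H.lapMatrix ℝ *ᵥ f = 0 := by
    rw [dotProduct_mulVec, ← mulVec_transpose, (H.isSymm_lapMatrix (R := ℝ)).eq]
    simp [SimpleGraph.lapMatrix_mulVec_const_eq_zero]
  simpa [dotProduct] using h

/-- On a connected graph, a pseudoinverse of the Laplacian solves the Poisson equation for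
divisors of degree zero. -/
theorem IsMoorePenrose.lapMatrix_mulVec_mulVec {W : Type*} [Fintype W] [DecidableEq W]
    {H : SimpleGraph W} [DecidableRel H.Adj] (hH : H.Connected) {P : Matrix W W ℝ}
    (hP : IsMoorePenrose (H.lapMatrix ℝ) P) {e : W → ℝ} (he : ∑ x, e x = 0) :
    H.lapMatrix ℝ *ᵥ (P *ᵥ e) = e := by
  obtain ⟨h₁, -, h₃, -⟩ := hP
  have hL : H.lapMatrix ℝ * (H.lapMatrix ℝ * P) = H.lapMatrix ℝ := by
    have h := congrArg Matrix.transpose h₁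
    rwa [transpose_mul, h₃, (H.isSymm_lapMatrix (R := ℝ)).eq] at h
  set w := e - H.lapMatrix ℝ *ᵥ (P *ᵥ e) with hw
  have hLw : H.lapMatrix ℝ *ᵥ w = 0 := by
    rw [hw, mulVec_sub, mulVec_mulVec, mulVec_mulVec, Matrix.mul_assoc, hL, sub_self]
  have hsum : ∑ x, w x = 0 := by
    simp only [hw, Pi.sub_apply, Finset.sum_sub_distrib, sum_lapMatrix_mulVec, he, sub_self]
  have hconst : ∀ x y, w x = w y := fun x y =>
    (H.lapMatrix_mulVec_eq_zero_iff_forall_reachable).mp hLw x y (hH.preconnected x y)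
  have hw0 : w = 0 := by
    funext x
    have : Nonempty W := ⟨x⟩
    rw [Finset.sum_congr rfl fun y _ => hconst y x] at hsum
    simpa using hsum
  exact (sub_eq_zero.mp hw0).symm

/-- A pseudoinverse of a symmetric matrix `L` pairs `L k` with `L f` as `L` pairs `k` with `f`. -/
theorem IsMoorePenrose.dotProduct_mulVec_mulVec {W : Type*} [Fintype W]
    {L P : Matrix W W ℝ} (hL : L.IsSymm) (hP : IsMoorePenrose L P) (k f : W → ℝ) :
    (L *ᵥ k) ⬝ᵥ P *ᵥ (L *ᵥ f) = (L *ᵥ k) ⬝ᵥ f := by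
  have h (u : W → ℝ) : (L *ᵥ k) ⬝ᵥ u = k ⬝ᵥ L *ᵥ u := by
    rw [dotProduct_mulVec, ← mulVec_transpose, hL.eq]
  rw [h, h, mulVec_mulVec, mulVec_mulVec, hP.1]

/-- If `S` is joined to `T` only through `v`, then the Laplacian of the induced subgraph on
`S ∪ {v}` sends the restriction of `f` to the pushforward of the Laplacian of `f`. -/
theorem lapMatrix_induce_mulVec_restrict {V : Type*} [Fintype V] [DecidableEq V]
    (G : SimpleGraph V) [DecidableRel G.Adj] {v : V} {S T : Finset V}
    (hST : Disjoint S T) (hvS : v ∉ S) (hvT : v ∉ T)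
    (hpart : ∀ x : V, x ≠ v → x ∈ S ∨ x ∈ T)
    (hsep : ∀ s ∈ S, ∀ t ∈ T, ¬ G.Adj s t)
    [DecidableRel (G.induce (↑(insert v S) : Set V)).Adj]
    {f d : V → ℝ} (hf : G.lapMatrix ℝ *ᵥ f = d) :
    (G.induce (↑(insert v S) : Set V)).lapMatrix ℝ *ᵥ (fun x => f x) =
      fun x : (↑(insert v S) : Set V) =>
        if (x : V) = v then d v + ∑ t ∈ T, d t else d (x : V) := by
  set r := (G.induce (↑(insert v S) : Set V)).lapMatrix ℝ *ᵥ (fun x => f x) with hr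
  set D : V → ℝ := fun y => if y = v then d v + ∑ t ∈ T, d t else d y with hD
  have hsub (F : V → ℝ) : ∑ x : (↑(insert v S) : Set V), F x = ∑ x ∈ insert v S, F x :=
    (Finset.sum_subtype _ (by simp) F).symm
  have hne (x : (↑(insert v S) : Set V)) (hx : (x : V) ≠ v) : r x = D x := by
    have hxS : (x : V) ∈ S := by simpa [hx] using x.2
    rw [hr, lapMatrix_mulVec_eq_sum_ite, hD]
    simp only [hx, if_false, SimpleGraph.comap_adj, Function.Embedding.subtype_apply]
    rw [← hf, lapMatrix_mulVec_eq_sum_ite,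
      hsub fun y => if G.Adj x y then f x - f y else 0]
    refine Finset.sum_subset (Finset.subset_univ _) fun y _ hy => if_neg ?_
    rw [Finset.mem_insert, not_or] at hy
    exact hsep x hxS y ((hpart y hy.1).resolve_left hy.2)
  have hdeg : ∑ x ∈ S, d x + (d v + ∑ x ∈ T, d x) = 0 := by
    have huniv : (Finset.univ : Finset V) = S ∪ insert v T := by
      ext x
      have := hpart x
      simp only [Finset.mem_univ, Finset.mem_union, Finset.mem_insert, true_iff]
      tauto
    have h := sum_lapMatrix_mulVec G f
    rwa [hf, huniv, Finset.sum_union (Finset.disjoint_insert_right.mpr ⟨hvS, hST⟩),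
      Finset.sum_insert hvT] at h
  have hDsum : ∑ x : (↑(insert v S) : Set V), D x = 0 := by
    rw [hsub, Finset.sum_insert hvS, add_comm, ← hdeg, hD]
    congr 1
    · exact Finset.sum_congr rfl fun x hx => if_neg (ne_of_mem_of_not_mem hx hvS)
    · exact if_pos rfl
  funext x
  change r x = D x
  by_cases hx : (x : V) = v
  · have h : ∑ y, (r y - D y) = 0 := by
      rw [Finset.sum_sub_distrib, hDsum, hr, sum_lapMatrix_mulVec, sub_self]
    rw [Fintype.sum_eq_single x fun y hy => sub_eq_zero.mpr
      (hne y fun hyv => hy (Subtype.ext (hyv.trans hx.symm)))] at h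
    exact sub_eq_zero.mp h
  · exact hne x hx

/-- Pairing a pushforward with a restricted function. -/
theorem pushforward_dotProduct_restrict {V : Type*} [DecidableEq V]
    {v : V} {S : Finset V} (hvS : v ∉ S) (c : ℝ) (d f : V → ℝ) :
    (fun x : (↑(insert v S) : Set V) => if (x : V) = v then c else d (x : V)) ⬝ᵥ
      (fun x => f x) = c * f v + ∑ s ∈ S, d s * f s := by
  have hsub (F : V → ℝ) : ∑ x : (↑(insert v S) : Set V), F x = ∑ x ∈ insert v S, F x :=
    (Finset.sum_subtype _ (by simp) F).symm
  rw [dotProduct, hsub fun x => (if x = v then c else d x) * f x, Finset.sum_insert hvS,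
    if_pos rfl]
  congr 1
  exact Finset.sum_congr rfl fun x hx => by rw [if_neg (ne_of_mem_of_not_mem hx hvS)]

/-- Additivity of the Green pairing over a cut vertex: if `v` separates `V \ {v}` into
nonempty pieces `S` and `T` with no edge between them, then for all divisors `d, e` of
degree zero, `g_G(d,e) = g_{G₁}(π₁d, π₁e) + g_{G₂}(π₂d, π₂e)`, where `G₁`, `G₂` are the
induced subgraphs on `S ∪ {v}`, `T ∪ {v}` and `π₁`, `π₂` the pushforward maps collapsing
the other piece onto `v`. -/
theorem green_pairing_additivity_cut_vertex
    {V : Type*} [Fintype V] [DecidableEq V]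
    (G : SimpleGraph V) [DecidableRel G.Adj] (hG : G.Connected)
    (v : V) (S T : Finset V)
    (hS : S.Nonempty) (hT : T.Nonempty) (hST : Disjoint S T)
    (hvS : v ∉ S) (hvT : v ∉ T)
    (hpart : ∀ x : V, x ≠ v → x ∈ S ∨ x ∈ T)
    (hsep : ∀ s ∈ S, ∀ t ∈ T, ¬ G.Adj s t)
    [DecidableRel (G.induce (↑(insert v S) : Set V)).Adj]
    [DecidableRel (G.induce (↑(insert v T) : Set V)).Adj]
    (Lp : Matrix V V ℝ)
    (hLp : IsMoorePenrose (G.lapMatrix ℝ) Lp)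
    (Lp₁ : Matrix (↑(insert v S) : Set V) (↑(insert v S) : Set V) ℝ)
    (hLp₁ : IsMoorePenrose ((G.induce (↑(insert v S) : Set V)).lapMatrix ℝ) Lp₁)
    (Lp₂ : Matrix (↑(insert v T) : Set V) (↑(insert v T) : Set V) ℝ)
    (hLp₂ : IsMoorePenrose ((G.induce (↑(insert v T) : Set V)).lapMatrix ℝ) Lp₂) :
    ∀ d e : V → ℝ, ∑ x : V, d x = 0 → ∑ x : V, e x = 0 →
      d ⬝ᵥ Lp.mulVec e =
        (fun x : (↑(insert v S) : Set V) =>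
            if (x : V) = v then d v + ∑ t ∈ T, d t else d (x : V)) ⬝ᵥ
          Lp₁.mulVec (fun x : (↑(insert v S) : Set V) =>
            if (x : V) = v then e v + ∑ t ∈ T, e t else e (x : V)) +
        (fun x : (↑(insert v T) : Set V) =>
            if (x : V) = v then d v + ∑ s ∈ S, d s else d (x : V)) ⬝ᵥ
          Lp₂.mulVec (fun x : (↑(insert v T) : Set V) =>
            if (x : V) = v then e v + ∑ s ∈ S, e s else e (x : V)) := by
  intro d e hd he
  have hk := hLp.lapMatrix_mulVec_mulVec hG hd
  have hf := hLp.lapMatrix_mulVec_mulVec hG he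
  have hpart' : ∀ x : V, x ≠ v → x ∈ T ∨ x ∈ S := fun x hx => (hpart x hx).symm
  have hsep' : ∀ t ∈ T, ∀ s ∈ S, ¬ G.Adj t s := fun t ht s hs h => hsep s hs t ht h.symm
  rw [← lapMatrix_induce_mulVec_restrict G hST hvS hvT hpart hsep hk,
    ← lapMatrix_induce_mulVec_restrict G hST hvS hvT hpart hsep hf,
    ← lapMatrix_induce_mulVec_restrict G hST.symm hvT hvS hpart' hsep' hk,
    ← lapMatrix_induce_mulVec_restrict G hST.symm hvT hvS hpart' hsep' hf,
    hLp₁.dotProduct_mulVec_mulVec (SimpleGraph.isSymm_lapMatrix ℝ _),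
    hLp₂.dotProduct_mulVec_mulVec (SimpleGraph.isSymm_lapMatrix ℝ _),
    lapMatrix_induce_mulVec_restrict G hST hvS hvT hpart hsep hk,
    lapMatrix_induce_mulVec_restrict G hST.symm hvT hvS hpart' hsep' hk,
    pushforward_dotProduct_restrict hvS, pushforward_dotProduct_restrict hvT]
  have hsum (F : V → ℝ) : ∑ x, F x = F v + ∑ s ∈ S, F s + ∑ t ∈ T, F t := by
    have huniv : (Finset.univ : Finset V) = insert v (S ∪ T) := by
      ext x
      have := hpart x
      simp only [Finset.mem_univ, Finset.mem_union, Finset.mem_insert, true_iff]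
      tauto
    rw [huniv, Finset.sum_insert (by simp [hvS, hvT]), Finset.sum_union hST, add_assoc]
  rw [hsum] at hd
  rw [dotProduct, hsum]
  linear_combination (-(Lp *ᵥ e) v) * hd
end
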